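/- Let ε > 1, t₀ > 0, and λ = (λ₁,λ₂) ∈ ℝ² with λ₁λ₂ ≠ 0, and set λₙ := (ε^n·λ₁, ε^{−n}·λ₂) for n ∈ ℤ. Then lim_{v→∞} (∑_{n∈ℤ} β_{t₀}(√v·λₙ))/K₀(2π·|λ₁λ₂|·v) = 0. -/

import Mathlib

open Real MeasureTheory

/-- `K₀(x) = ∫₀^∞ exp(-x cosh T) dT` for `x > 0` (the Lean integral is `0` at `x = 0`,
matching the convention `K₀(0) := 0`). -/
noncomputable def K0 (x : ℝ) : ℝ := ∫ T in Set.Ioi (0:ℝ), Real.exp (-x * Real.cosh T)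

/-- The incomplete version `K₀(x; a) = sgn(a) ∫_{|a|}^∞ exp(-x cosh T) dT`. -/
noncomputable def K0inc (x a : ℝ) : ℝ :=
  Real.sign a * ∫ T in Set.Ioi |a|, Real.exp (-x * Real.cosh T)
/-- The hyperbolic quadratic form `Q₀((x₁,x₂)) = x₁x₂` on `ℝ²`. -/
def Q0 (w : ℝ × ℝ) : ℝ := w.1 * w.2

/-- `λ_t⁺ = (λ₁ t⁻¹ + λ₂ t)/2`. -/
noncomputable def lamP (w : ℝ × ℝ) (t : ℝ) : ℝ := (w.1 / t + w.2 * t) / 2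

/-- `λ_t⁻ = (−λ₁ t⁻¹ + λ₂ t)/2`. -/
noncomputable def lamM (w : ℝ × ℝ) (t : ℝ) : ℝ := (-w.1 / t + w.2 * t) / 2

/-- Zwegers' function `β_{t₀}(w)`. -/
noncomputable def betaF (t₀ : ℝ) (w : ℝ × ℝ) : ℝ :=
  if 0 < lamM w t₀ * lamP w t₀ then
    Real.exp (-(2 * π * Q0 w)) * ∫ t in Set.Ioi t₀, Real.exp (-(4 * π * (lamM w t)^2)) / t
  else if lamM w t₀ * lamP w t₀ < 0 then
    -(Real.exp (-(2 * π * Q0 w)) * ∫ t in Set.Ioc (0:ℝ) t₀, Real.exp (-(4 * π * (lamM w t)^2)) / t)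
  else 0

/-- The coefficient `a_λ(t₁,t₂)` (for `Q₀(λ) ≠ 0`). -/
noncomputable def aCoef (t₁ t₂ : ℝ) (w : ℝ × ℝ) : ℝ :=
  if Q0 w < 0 then (1 - Real.sign (lamP w t₁ * lamP w t₂)) / 2
  else (1 - Real.sign (lamM w t₁ * lamM w t₂)) / 2

lemma aux_alg (p q y z : ℝ) (hp : 0 ≤ p) (hpq : p ≤ q) (hy : 1 ≤ y) (hz : z ≤ 1) :
    (q - p) ^ 2 + p * q * (y + z) ≤ p ^ 2 * z + q ^ 2 * y := by
  have h1 : 0 ≤ q * (y - 1) * (q - p) :=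
    mul_nonneg (mul_nonneg (by linarith) (by linarith)) (by linarith)
  have h2 : 0 ≤ p * (1 - z) * (q - p) :=
    mul_nonneg (mul_nonneg (by linarith) (by linarith)) (by linarith)
  nlinarith

lemma aux_eq (w : ℝ × ℝ) (t : ℝ) (ht : 0 < t) :
    Real.exp (-(2 * π * Q0 w)) * (t / 2 * (Real.exp (-(4 * π * (lamM w t)^2)) / t))
      = 1 / 2 * Real.exp (-(π * (w.1 ^ 2 / t ^ 2 + w.2 ^ 2 * t ^ 2))) := by
  have : -(π * (w.1 ^ 2 / t ^ 2 + w.2 ^ 2 * t ^ 2))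
      = -(2 * π * Q0 w) + -(4 * π * (lamM w t)^2) := by
    unfold Q0 lamM
    field_simp
    ring
  rw [this, Real.exp_add]
  field_simp

lemma aux_pt (w : ℝ × ℝ) (t₀ s σ : ℝ) (ht₀ : 0 < t₀) (hs : 0 ≤ s)
    (hσ : (σ = 1 / 2 ∧ |w.1| / t₀ ≤ |w.2| * t₀) ∨ (σ = -(1 / 2) ∧ |w.2| * t₀ ≤ |w.1| / t₀)) :
    Real.exp (-(2 * π * Q0 w)) * (|t₀ * (Real.exp (σ * s) * σ)| *
        (Real.exp (-(4 * π * (lamM w (t₀ * Real.exp (σ * s)))^2)) / (t₀ * Real.exp (σ * s))))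
      ≤ Real.exp (-(π * (|w.2| * t₀ - |w.1| / t₀) ^ 2)) *
        Real.exp (-(2 * π * |w.1 * w.2|) * Real.cosh s) := by
  have hE := Real.exp_pos (σ * s)
  have habs : |t₀ * (Real.exp (σ * s) * σ)| = (t₀ * Real.exp (σ * s)) / 2 := by
    have : |σ| = 1 / 2 := by rcases hσ with h | h <;> rw [h.1] <;> norm_num
    rw [abs_mul, abs_mul, this, abs_of_pos ht₀, abs_of_pos hE]; ring
  rw [habs, aux_eq w _ (by positivity), ← Real.exp_add]
  have hexp : (|w.2| * t₀ - |w.1| / t₀) ^ 2 + |w.1 * w.2| * (Real.exp s + Real.exp (-s))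
      ≤ w.1 ^ 2 / (t₀ * Real.exp (σ * s)) ^ 2 + w.2 ^ 2 * (t₀ * Real.exp (σ * s)) ^ 2 := by
    have h1 : 1 ≤ Real.exp s := Real.one_le_exp hs
    have h2 : Real.exp (-s) ≤ 1 := Real.exp_le_one_iff.2 (by linarith)
    have hpq : |w.1| / t₀ * (|w.2| * t₀) = |w.1 * w.2| := by rw [abs_mul]; field_simp
    have hsq : (Real.exp (σ * s)) ^ 2 = Real.exp (2 * σ * s) := by
      rw [← Real.exp_nat_mul]; congr 1; push_cast; ring
    have hR : w.1 ^ 2 / (t₀ * Real.exp (σ * s)) ^ 2 + w.2 ^ 2 * (t₀ * Real.exp (σ * s)) ^ 2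
      = (|w.1| / t₀) ^ 2 * Real.exp (-(2 * σ * s)) + (|w.2| * t₀) ^ 2 * Real.exp (2 * σ * s) := by
      rw [mul_pow, hsq, Real.exp_neg, div_pow, mul_pow, sq_abs, sq_abs]
      field_simp
    rw [hR]
    rcases hσ with ⟨rfl, h⟩ | ⟨rfl, h⟩
    · have := aux_alg _ _ _ _ (by positivity) h h1 h2
      rw [hpq] at this
      convert this using 4 <;> ring_nf
    · have := aux_alg _ _ _ _ (by positivity) h h1 h2
      rw [mul_comm (|w.2| * t₀), hpq] at this
      have e1 : -(2 * -(1 / 2) * s) = s := by ring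
      have e2 : (2 * -(1 / 2) * s) = -s := by ring
      rw [e1, e2]
      linarith [this, sub_sq_comm (|w.2| * t₀) (|w.1| / t₀)]
  have hmono := Real.exp_le_exp.2 (neg_le_neg (mul_le_mul_of_nonneg_left hexp Real.pi_pos.le))
  have hb : -(π * (|w.2| * t₀ - |w.1| / t₀) ^ 2) + -(2 * π * |w.1 * w.2|) * Real.cosh s
    = -(π * ((|w.2| * t₀ - |w.1| / t₀) ^ 2 + |w.1 * w.2| * (Real.exp s + Real.exp (-s)))) := by
    rw [Real.cosh_eq]; ring
  rw [hb]
  refine le_trans ?_ hmono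
  have := Real.exp_pos (-(π * (w.1 ^ 2 / (t₀ * Real.exp (σ * s)) ^ 2 + w.2 ^ 2 * (t₀ * Real.exp (σ * s)) ^ 2)))
  linarith

lemma aux_int (x : ℝ) (hx : 0 < x) :
    IntegrableOn (fun T : ℝ => Real.exp (-x * Real.cosh T)) (Set.Ioi 0) := by
  refine Integrable.mono' (exp_neg_integrableOn_Ioi 0 (half_pos hx)) (by fun_prop) ?_
  refine (ae_restrict_iff' measurableSet_Ioi).2 (Filter.Eventually.of_forall fun T hT => ?_)
  rw [Real.norm_eq_abs, abs_of_pos (Real.exp_pos _), Real.exp_le_exp, Real.cosh_eq]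
  have := Real.add_one_le_exp T
  have := Real.exp_pos (-T)
  nlinarith

lemma aux_bd (w : ℝ × ℝ) (t₀ σ : ℝ) (ht₀ : 0 < t₀) (hw : w.1 * w.2 ≠ 0)
    (hσ : (σ = 1 / 2 ∧ |w.1| / t₀ ≤ |w.2| * t₀) ∨ (σ = -(1 / 2) ∧ |w.2| * t₀ ≤ |w.1| / t₀))
    (S : Set ℝ) (hS : S = (fun s => t₀ * Real.exp (σ * s)) '' Set.Ici 0) :
    |Real.exp (-(2 * π * Q0 w)) * ∫ t in S, Real.exp (-(4 * π * (lamM w t)^2)) / t|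
      ≤ Real.exp (-(π * (|w.2| * t₀ - |w.1| / t₀) ^ 2)) * K0 (2 * π * |w.1 * w.2|) := by
  have hσ0 : σ ≠ 0 := by rcases hσ with h | h <;> rw [h.1] <;> norm_num
  rw [hS, integral_image_eq_integral_abs_deriv_smul measurableSet_Ici
    (f' := fun s => t₀ * (Real.exp (σ * s) * σ))
    (fun s _ => by
      have := (((hasDerivAt_id s).const_mul σ).exp).const_mul t₀
      simpa using this.hasDerivWithinAt)
    (fun a _ b _ h => by
      have h1 := mul_left_cancel₀ ht₀.ne' h
      exact mul_left_cancel₀ hσ0 (Real.exp_injective h1)),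
    integral_Ici_eq_integral_Ioi, ← integral_const_mul, K0, ← integral_const_mul]
  simp only [smul_eq_mul]
  have hnn : ∀ s : ℝ, 0 ≤ Real.exp (-(2 * π * Q0 w)) * (|t₀ * (Real.exp (σ * s) * σ)| *
        (Real.exp (-(4 * π * (lamM w (t₀ * Real.exp (σ * s)))^2)) / (t₀ * Real.exp (σ * s)))) :=
    fun s => by positivity
  rw [abs_of_nonneg (integral_nonneg hnn)]
  refine integral_mono_of_nonneg (Filter.Eventually.of_forall hnn) ?_ ?_
  · exact (aux_int _ (by positivity)).const_mul _
  · exact (ae_restrict_iff' measurableSet_Ioi).2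
      (Filter.Eventually.of_forall fun s hs => aux_pt w t₀ s σ ht₀ (le_of_lt hs) hσ)

lemma aux_MP (w : ℝ × ℝ) (t : ℝ) (ht : 0 < t) :
    lamM w t * lamP w t = ((|w.2| * t) ^ 2 - (|w.1| / t) ^ 2) / 4 := by
  unfold lamM lamP
  rw [mul_pow, div_pow, sq_abs, sq_abs]
  ring

lemma betaF_bd (w : ℝ × ℝ) (t₀ : ℝ) (ht₀ : 0 < t₀) (hw : w.1 * w.2 ≠ 0) :
    |betaF t₀ w|
      ≤ Real.exp (-(π * (|w.2| * t₀ - |w.1| / t₀) ^ 2)) * K0 (2 * π * |w.1 * w.2|) := by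
  unfold betaF
  have hMP := aux_MP w t₀ ht₀
  split_ifs with h1 h2
  · have h : |w.1| / t₀ ≤ |w.2| * t₀ := by
      refine le_of_lt (lt_of_pow_lt_pow_left₀ 2 (by positivity) (by linarith))
    rw [← integral_Ici_eq_integral_Ioi]
    refine aux_bd w t₀ (1 / 2) ht₀ hw (Or.inl ⟨rfl, h⟩) _ ?_
    ext t
    simp only [Set.mem_Ici, Set.mem_image]
    constructor
    · intro ht
      refine ⟨2 * Real.log (t / t₀), ?_, ?_⟩
      · have := Real.log_nonneg ((one_le_div ht₀).2 ht)
        linarith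
      · rw [show (1 / 2 : ℝ) * (2 * Real.log (t / t₀)) = Real.log (t / t₀) by ring,
          Real.exp_log (div_pos (by linarith) ht₀)]
        field_simp
    · rintro ⟨s, hs, rfl⟩
      have : 1 ≤ Real.exp (1 / 2 * s) := Real.one_le_exp (by linarith)
      nlinarith
  · have h : |w.2| * t₀ ≤ |w.1| / t₀ := by
      refine le_of_lt (lt_of_pow_lt_pow_left₀ 2 (by positivity) (by linarith))
    rw [abs_neg]
    refine aux_bd w t₀ (-(1 / 2)) ht₀ hw (Or.inr ⟨rfl, h⟩) _ ?_
    ext t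
    simp only [Set.mem_Ici, Set.mem_image, Set.mem_Ioc]
    constructor
    · rintro ⟨ht, htt⟩
      refine ⟨-(2 * Real.log (t / t₀)), ?_, ?_⟩
      · have := Real.log_nonpos (by positivity) ((div_le_one ht₀).2 htt)
        linarith
      · rw [show -(1 / 2 : ℝ) * -(2 * Real.log (t / t₀)) = Real.log (t / t₀) by ring,
          Real.exp_log (div_pos (by linarith) ht₀)]
        field_simp
    · rintro ⟨s, hs, rfl⟩
      have : Real.exp (-(1 / 2) * s) ≤ 1 := Real.exp_le_one_iff.2 (by linarith)
      have := Real.exp_pos (-(1 / 2) * s)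
      exact ⟨by positivity, by nlinarith⟩
  · rw [abs_zero]
    exact mul_nonneg (Real.exp_pos _).le (integral_nonneg fun _ => (Real.exp_pos _).le)

lemma aux_geom (ε c : ℝ) (hε : 1 < ε) (hc : 0 < c) :
    Summable (fun n : ℕ => Real.exp (-(c * (ε ^ n) ^ 2))) := by
  have hg : Summable (fun n : ℕ => c⁻¹ * ε⁻¹ ^ n) :=
    (summable_geometric_of_lt_one (by positivity) (inv_lt_one_of_one_lt₀ hε)).mul_left _
  refine Summable.of_nonneg_of_le (fun _ => (Real.exp_pos _).le) (fun n => ?_) hg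
  have h1 : 1 ≤ ε ^ n := one_le_pow₀ hε.le
  have h2 := Real.add_one_le_exp (c * (ε ^ n) ^ 2)
  rw [Real.exp_neg, inv_pow, ← mul_inv]
  apply inv_anti₀ (by positivity)
  have : c * ε ^ n ≤ c * (ε ^ n) ^ 2 := by
    apply mul_le_mul_of_nonneg_left _ hc.le
    nlinarith
  linarith

lemma aux_sum (ε p q : ℝ) (hε : 1 < ε) (hp : 0 < p) (hq : 0 < q) :
    Summable (fun n : ℤ => Real.exp (-(π * (ε ^ (-n) * q - ε ^ n * p) ^ 2))) := by
  have hε0 : 0 < ε := by linarith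
  have hle : ∀ n : ℤ, (ε ^ (-n) * q - ε ^ n * p) ^ 2
      = q ^ 2 * (ε ^ (-n)) ^ 2 + p ^ 2 * (ε ^ n) ^ 2 - 2 * p * q := by
    intro n
    have : ε ^ (-n) * ε ^ n = 1 := by rw [← zpow_add₀ hε0.ne']; simp
    linear_combination (-2 * p * q) * this
  have hbd : ∀ r : ℝ, 0 < r → Summable (fun n : ℕ =>
      Real.exp (2 * π * p * q) * Real.exp (-(π * r ^ 2 * (ε ^ n) ^ 2))) :=
    fun r hr => (aux_geom ε _ hε (by positivity)).mul_left _
  refine Summable.of_nat_of_neg ?_ ?_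
  · refine Summable.of_nonneg_of_le (fun _ => (Real.exp_pos _).le) (fun n => ?_) (hbd p hp)
    rw [← Real.exp_add, Real.exp_le_exp, hle, zpow_natCast]
    have : 0 ≤ π * (q ^ 2 * (ε ^ (-(n : ℤ))) ^ 2) := by positivity
    linarith
  · refine Summable.of_nonneg_of_le (fun _ => (Real.exp_pos _).le) (fun n => ?_) (hbd q hq)
    rw [← Real.exp_add, Real.exp_le_exp, hle, neg_neg, zpow_natCast]
    have : 0 ≤ π * (p ^ 2 * (ε ^ (-(n : ℤ))) ^ 2) := by positivity
    linarith

/-- The orbit sum of `β_{t₀}` terms is negligible against `K₀`: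
`lim_{v→∞} (∑_{n∈ℤ} β_{t₀}(√v λₙ)) / K₀(2π|λ₁λ₂|v) = 0` where `λₙ = (εⁿλ₁, ε⁻ⁿλ₂)`. -/
theorem sum_betaF_div_K0_tendsto_zero (ε t₀ : ℝ) (hε : 1 < ε) (ht₀ : 0 < t₀)
    (lam : ℝ × ℝ) (hlam : lam.1 * lam.2 ≠ 0) :
    Filter.Tendsto (fun v : ℝ =>
        (∑' n : ℤ, betaF t₀ (Real.sqrt v * (ε ^ n * lam.1), Real.sqrt v * (ε ^ (-n) * lam.2)))
          / K0 (2 * π * |lam.1 * lam.2| * v))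
      Filter.atTop (nhds 0) := by
  have hε0 : 0 < ε := by linarith
  obtain ⟨hl1, hl2⟩ := mul_ne_zero_iff.1 hlam
  set p := |lam.1| / t₀ with hp
  set q := |lam.2| * t₀ with hq
  have hp0 : 0 < p := by positivity
  have hq0 : 0 < q := by positivity
  have hbd : ∀ v : ℝ, 0 < v → ∀ n : ℤ,
      |betaF t₀ (Real.sqrt v * (ε ^ n * lam.1), Real.sqrt v * (ε ^ (-n) * lam.2))
        / K0 (2 * π * |lam.1 * lam.2| * v)|
        ≤ Real.exp (-(π * (ε ^ (-n) * q - ε ^ n * p) ^ 2) * v) := by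
    intro v hv n
    have hz : ε ^ n * ε ^ (-n) = 1 := by rw [← zpow_add₀ hε0.ne']; simp
    have hs : Real.sqrt v * Real.sqrt v = v := Real.mul_self_sqrt hv.le
    have hprod : (Real.sqrt v * (ε ^ n * lam.1)) * (Real.sqrt v * (ε ^ (-n) * lam.2))
        = v * (lam.1 * lam.2) := by
      linear_combination (lam.1 * lam.2 * Real.sqrt v * Real.sqrt v) * hz + lam.1 * lam.2 * hs
    have h := betaF_bd (Real.sqrt v * (ε ^ n * lam.1), Real.sqrt v * (ε ^ (-n) * lam.2)) t₀ ht₀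
      (by simp only [hprod]; positivity)
    simp only [hprod] at h
    have hK : 0 ≤ K0 (2 * π * |lam.1 * lam.2| * v) :=
      integral_nonneg fun _ => (Real.exp_pos _).le
    rw [abs_div, abs_of_nonneg hK]
    refine div_le_of_le_mul₀ hK (Real.exp_pos _).le ?_
    refine h.trans (le_of_eq ?_)
    congr 2
    · symm
      rw [abs_mul, abs_mul, abs_mul, abs_mul, abs_of_nonneg (Real.sqrt_nonneg v),
        abs_of_pos (zpow_pos hε0 n), abs_of_pos (zpow_pos hε0 (-n)), hp, hq]
      linear_combination (-π * (ε ^ (-n) * (|lam.2| * t₀) - ε ^ n * (|lam.1| / t₀)) ^ 2) * (-hs)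
    · rw [abs_mul v, abs_of_pos hv]; ring
  simp_rw [← tsum_div_const]
  rw [← tsum_zero (α := ℝ) (β := ℤ)]
  refine tendsto_tsum_of_dominated_convergence (aux_sum ε p q hε hp0 hq0) ?_ ?_
  · intro n
    by_cases hd : ε ^ (-n) * q - ε ^ n * p = 0
    · refine tendsto_const_nhds.congr fun v => ?_
      have : lamM (Real.sqrt v * (ε ^ n * lam.1), Real.sqrt v * (ε ^ (-n) * lam.2)) t₀ *
          lamP (Real.sqrt v * (ε ^ n * lam.1), Real.sqrt v * (ε ^ (-n) * lam.2)) t₀ = 0 := by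
        rw [aux_MP _ _ ht₀]
        simp only [abs_mul, abs_of_nonneg (Real.sqrt_nonneg v),
          abs_of_pos (zpow_pos hε0 n), abs_of_pos (zpow_pos hε0 (-n))]
        rw [hp, hq] at hd
        have hd' : ε ^ (-n) * (|lam.2| * t₀) = ε ^ n * (|lam.1| / t₀) := by linarith
        rw [show Real.sqrt v * (ε ^ (-n) * |lam.2|) * t₀
          = Real.sqrt v * (ε ^ (-n) * (|lam.2| * t₀)) by ring, hd']
        ring
      rw [betaF, if_neg (by rw [this]; exact lt_irrefl _), if_neg (by rw [this]; exact lt_irrefl _),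
        zero_div]
    · have hpos : 0 < π * (ε ^ (-n) * q - ε ^ n * p) ^ 2 := by positivity
      refine squeeze_zero_norm' (a := fun v => Real.exp (-(π * (ε ^ (-n) * q - ε ^ n * p) ^ 2) * v))
        ?_ ?_
      · filter_upwards [Filter.eventually_gt_atTop 0] with v hv
        exact hbd v hv n
      · exact Real.tendsto_exp_atBot.comp
          (Filter.tendsto_id.const_mul_atTop_of_neg (neg_lt_zero.2 hpos))
  · filter_upwards [Filter.eventually_ge_atTop 1] with v hv n
    refine (hbd v (by linarith) n).trans (Real.exp_le_exp.2 ?_)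
    have : 0 ≤ π * (ε ^ (-n) * q - ε ^ n * p) ^ 2 := by positivity
    nlinarith
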